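/- If Z ∈ L²(ℝ³, |ξ| dξ), i.e. Z(ξ) = |ξ|^(−1/2) Z₀(ξ) with Z₀ ∈ L²(ℝ³), then the function ξ ↦ |ξ|^(−1) (Z ∗ Z)(ξ) also belongs to L²(ℝ³, |ξ| dξ); moreover ‖|ξ|^(−1)(Z∗Z)‖_{L²(|ξ|dξ)} ≤ C ‖Z‖²_{L²(|ξ|dξ)} for a universal constant C. -/

import Mathlib

open MeasureTheory
open scoped ENNReal NNReal

/-- The Euclidean space of dimension three. -/
abbrev E3 : Type := EuclideanSpace ℝ (Fin 3)

/-- The norm as an extended nonnegative real. -/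
noncomputable def nn (x : E3) : ℝ≥0∞ := ENNReal.ofReal ‖x‖

lemma measurable_nn : Measurable nn := by
  unfold nn; fun_prop

lemma nn_ne_top (x : E3) : nn x ≠ ⊤ := ENNReal.ofReal_ne_top

lemma nn_ne_zero {x : E3} (hx : x ≠ 0) : nn x ≠ 0 := by
  simp [nn, hx]

lemma ae_ne_zero3 : ∀ᵐ x : E3, x ≠ 0 := by
  simp [ae_iff]

/-- The inverse square norm is integrable on balls, with linear growth. -/
lemma ball_bound : ∃ C : ℝ≥0, ∀ r : ℝ, 0 ≤ r →
    ∫⁻ x : E3, (if ‖x‖ ≤ r then ((nn x)⁻¹) ^ 2 else 0) ≤ C * ENNReal.ofReal r := by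
  refine ⟨3 * (volume (Metric.ball (0 : E3) 1)).toNNReal, fun r hr => ?_⟩
  set f : ℝ → ℝ := (Set.Ioc 0 r).indicator (fun y => (y ^ 2)⁻¹) with hf
  have hfn : ∀ y, 0 ≤ f y := fun y => Set.indicator_nonneg (fun y _ => by positivity) y
  have key : Set.EqOn (fun y : ℝ => y ^ (Module.finrank ℝ E3 - 1) • f y)
      ((Set.Ioc 0 r).indicator (fun _ => (1 : ℝ))) (Set.Ioi 0) := by
    intro y hy
    have hy' : (0 : ℝ) < y := hy
    by_cases h : y ≤ r
    · simp [hf, h, hy', hy'.ne']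
    · simp [hf, h]
  have hint : Integrable (fun x : E3 => f ‖x‖) volume := by
    rw [integrable_fun_norm_addHaar, integrableOn_congr_fun key measurableSet_Ioi]
    apply Integrable.integrableOn
    rw [integrable_indicator_iff measurableSet_Ioc]
    simp
  have h1 : ∫⁻ x : E3, (if ‖x‖ ≤ r then ((nn x)⁻¹) ^ 2 else 0)
      = ∫⁻ x : E3, ENNReal.ofReal (f ‖x‖) := by
    apply lintegral_congr_ae
    filter_upwards [ae_ne_zero3] with x hx
    have hx' : 0 < ‖x‖ := norm_pos_iff.2 hx
    by_cases h : ‖x‖ ≤ r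
    · simp only [h, if_true, hf, nn]
      rw [Set.indicator_of_mem (by exact ⟨hx', h⟩), ENNReal.ofReal_inv_of_pos (by positivity),
        ENNReal.ofReal_pow (norm_nonneg _), ENNReal.inv_pow]
    · simp [h, hf]
  rw [h1, ← ofReal_integral_eq_lintegral_ofReal hint (Filter.Eventually.of_forall fun x => hfn _),
    integral_fun_norm_addHaar, setIntegral_congr_fun measurableSet_Ioi key,
    setIntegral_indicator measurableSet_Ioc]
  have : Set.Ioi (0 : ℝ) ∩ Set.Ioc 0 r = Set.Ioc 0 r := by
    ext y; simp
  rw [this]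
  simp only [finrank_euclideanSpace, Fintype.card_fin, integral_const, MeasurableSet.univ,
    measureReal_restrict_apply, Set.univ_inter, Real.volume_real_Ioc_of_le hr, smul_eq_mul,
    nsmul_eq_mul, sub_zero, mul_one]
  rw [ENNReal.ofReal_mul (by positivity), ENNReal.ofReal_mul (by positivity), ← mul_assoc]
  apply le_of_eq
  congr 1
  push_cast
  rw [ENNReal.coe_toNNReal measure_ball_lt_top.ne, ofReal_measureReal measure_ball_lt_top.ne]
  norm_num

lemma mul_le_sq_add_sq (a b : ℝ≥0∞) : a * b ≤ a ^ 2 + b ^ 2 := by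
  rcases le_total a b with h | h
  · calc a * b ≤ b * b := by gcongr
      _ = b ^ 2 := (sq b).symm
      _ ≤ _ := le_add_self
  · calc a * b ≤ a * a := by gcongr
      _ = a ^ 2 := (sq a).symm
      _ ≤ _ := le_self_add

lemma kernel_bound : ∃ C : ℝ≥0, ∀ b : E3,
    ∫⁻ y : E3, (if ‖y‖ ≤ ‖b‖ then (nn (b + y))⁻¹ * (nn y)⁻¹ else 0) ≤ C * nn b := by
  obtain ⟨C, hC⟩ := ball_bound
  refine ⟨3 * C, fun b => ?_⟩
  have hm : Measurable (fun x : E3 => if ‖x‖ ≤ 2 * ‖b‖ then ((nn x)⁻¹) ^ 2 else 0) :=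
    Measurable.ite (measurableSet_le (by fun_prop) (by fun_prop))
      (measurable_nn.inv.pow_const 2) measurable_const
  calc ∫⁻ y : E3, (if ‖y‖ ≤ ‖b‖ then (nn (b + y))⁻¹ * (nn y)⁻¹ else 0)
      ≤ ∫⁻ y : E3, ((if ‖b + y‖ ≤ 2 * ‖b‖ then ((nn (b + y))⁻¹) ^ 2 else 0) +
          (if ‖y‖ ≤ ‖b‖ then ((nn y)⁻¹) ^ 2 else 0)) := by
        apply lintegral_mono
        intro y
        by_cases h : ‖y‖ ≤ ‖b‖
        · have h2 : ‖b + y‖ ≤ 2 * ‖b‖ := (norm_add_le _ _).trans (by linarith)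
          simp only [h, h2, if_true]
          exact mul_le_sq_add_sq _ _
        · simp [h]
    _ = (∫⁻ y : E3, (if ‖b + y‖ ≤ 2 * ‖b‖ then ((nn (b + y))⁻¹) ^ 2 else 0)) +
          ∫⁻ y : E3, (if ‖y‖ ≤ ‖b‖ then ((nn y)⁻¹) ^ 2 else 0) :=
        lintegral_add_left (hm.comp (measurable_const_add b)) _
    _ ≤ C * ENNReal.ofReal (2 * ‖b‖) + C * ENNReal.ofReal ‖b‖ := by
        gcongr
        · rw [lintegral_add_left_eq_self
            (fun y : E3 => if ‖y‖ ≤ 2 * ‖b‖ then ((nn y)⁻¹) ^ 2 else 0) b]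
          exact hC _ (by positivity)
        · exact hC _ (by positivity)
    _ = ((3 * C : ℝ≥0) : ℝ≥0∞) * nn b := by
        rw [ENNReal.ofReal_mul (by norm_num)]
        simp only [nn]
        push_cast
        rw [ENNReal.ofReal_ofNat]
        ring

/-- Cauchy-Schwarz in squared form. -/
lemma cs_sq (f g : E3 → ℝ≥0∞) (hf : Measurable f) (hg : Measurable g) :
    (∫⁻ x, f x * g x) ^ 2 ≤ (∫⁻ x, f x ^ 2) * ∫⁻ x, g x ^ 2 := by
  have h := ENNReal.lintegral_mul_le_Lp_mul_Lq (volume : Measure E3) Real.HolderConjugate.two_two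
    hf.aemeasurable hg.aemeasurable
  simp only [Pi.mul_apply, ENNReal.rpow_two] at h
  calc (∫⁻ x, f x * g x) ^ 2
      ≤ ((∫⁻ x, f x ^ 2) ^ ((1 : ℝ) / 2) * (∫⁻ x, g x ^ 2) ^ ((1 : ℝ) / 2)) ^ 2 := by gcongr
    _ = _ := by
      rw [mul_pow, ← ENNReal.rpow_two, ← ENNReal.rpow_two, ← ENNReal.rpow_mul, ← ENNReal.rpow_mul]
      norm_num

lemma cs_weighted (f g : E3 → ℝ≥0∞) (hf : Measurable f) (hg : Measurable g) :
    (∫⁻ x, g x * f x) ^ 2 ≤ (∫⁻ x, nn x * f x ^ 2) * ∫⁻ x, (nn x)⁻¹ * g x ^ 2 := by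
  have h := cs_sq (fun x => nn x ^ ((1 : ℝ) / 2) * f x) (fun x => ((nn x)⁻¹) ^ ((1 : ℝ) / 2) * g x)
    ((measurable_nn.pow_const _).mul hf) ((measurable_nn.inv.pow_const _).mul hg)
  have e : ∀ a : ℝ≥0∞, (a ^ ((1 : ℝ) / 2)) ^ 2 = a := by
    intro a
    rw [← ENNReal.rpow_two, ← ENNReal.rpow_mul]; norm_num
  simp only [mul_pow, e] at h
  refine le_trans (le_of_eq ?_) h
  congr 1
  apply lintegral_congr_ae
  filter_upwards [ae_ne_zero3] with x hx
  have : nn x ^ ((1 : ℝ) / 2) * ((nn x)⁻¹) ^ ((1 : ℝ) / 2) = 1 := by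
    rw [← ENNReal.mul_rpow_of_nonneg _ _ (by norm_num),
      ENNReal.mul_inv_cancel (nn_ne_zero hx) (nn_ne_top x), ENNReal.one_rpow]
  calc g x * f x = 1 * (g x * f x) := (one_mul _).symm
    _ = _ := by rw [← this]; ring

lemma conv_sq_bound (Z : E3 → ℝ≥0∞) (hZ : Measurable Z) (ξ : E3) :
    (∫⁻ η, Z (ξ - η) * Z η) ^ 2 ≤ 4 * ((∫⁻ x, nn x * Z x ^ 2) *
      ∫⁻ η, if ‖η‖ ≤ ‖ξ - η‖ then (nn η)⁻¹ * Z (ξ - η) ^ 2 else 0) := by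
  set g : E3 → ℝ≥0∞ := fun η => if ‖η‖ ≤ ‖ξ - η‖ then Z (ξ - η) else 0 with hg
  have hgm : Measurable g :=
    Measurable.ite (measurableSet_le (by fun_prop) (by fun_prop))
      (hZ.comp (measurable_const.sub measurable_id)) measurable_const
  have h1 : ∫⁻ η, Z (ξ - η) * Z η ≤ 2 * ∫⁻ η, g η * Z η := by
    calc ∫⁻ η, Z (ξ - η) * Z η ≤ ∫⁻ η, (g η * Z η + g (ξ - η) * Z (ξ - η)) := by
          apply lintegral_mono
          intro η
          simp only [hg, sub_sub_cancel]
          rcases le_total ‖η‖ ‖ξ - η‖ with h | h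
          · simp only [h, if_true]; exact le_self_add
          · simp only [h, if_true]; rw [mul_comm (Z (ξ - η))]; exact le_add_self
      _ = (∫⁻ η, g η * Z η) + ∫⁻ η, g (ξ - η) * Z (ξ - η) :=
          lintegral_add_left (hgm.mul hZ) _
      _ = 2 * ∫⁻ η, g η * Z η := by
          rw [lintegral_sub_left_eq_self (fun η => g η * Z η) ξ, two_mul]
  have h2 := cs_weighted Z g hZ hgm
  calc (∫⁻ η, Z (ξ - η) * Z η) ^ 2 ≤ (2 * ∫⁻ η, g η * Z η) ^ 2 := by gcongr
    _ = 4 * (∫⁻ η, g η * Z η) ^ 2 := by rw [mul_pow]; norm_num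
    _ ≤ 4 * ((∫⁻ x, nn x * Z x ^ 2) * ∫⁻ x, (nn x)⁻¹ * g x ^ 2) := by gcongr
    _ = _ := by
      congr 3
      funext η
      simp only [hg]
      split_ifs <;> simp

/-- The kernel appearing after Cauchy-Schwarz. -/
noncomputable def kk (Z : E3 → ℝ≥0∞) (p : E3 × E3) : ℝ≥0∞ :=
  (nn p.1)⁻¹ * if ‖p.2‖ ≤ ‖p.1 - p.2‖ then (nn p.2)⁻¹ * Z (p.1 - p.2) ^ 2 else 0

lemma measurable_kk (Z : E3 → ℝ≥0∞) (hZ : Measurable Z) : Measurable (kk Z) := by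
  have h1 : Measurable fun p : E3 × E3 => (nn p.1)⁻¹ := (measurable_nn.comp measurable_fst).inv
  have h2 : Measurable fun p : E3 × E3 => (nn p.2)⁻¹ := (measurable_nn.comp measurable_snd).inv
  have h3 : Measurable fun p : E3 × E3 => Z (p.1 - p.2) ^ 2 :=
    (hZ.comp (measurable_fst.sub measurable_snd)).pow_const 2
  have h4 : MeasurableSet {p : E3 × E3 | ‖p.2‖ ≤ ‖p.1 - p.2‖} :=
    measurableSet_le (by fun_prop) (by fun_prop)
  exact h1.mul (Measurable.ite h4 (h2.mul h3) measurable_const)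

lemma kk_swap (Z : E3 → ℝ≥0∞) (hZ : Measurable Z) :
    ∫⁻ ξ, ∫⁻ η, kk Z (ξ, η) = ∫⁻ b, ∫⁻ η, kk Z (b + η, η) := by
  have hkm := measurable_kk Z hZ
  have hkm2 : Measurable (fun p : E3 × E3 => kk Z (p.2 + p.1, p.1)) :=
    hkm.comp ((measurable_snd.add measurable_fst).prodMk measurable_fst)
  calc ∫⁻ ξ, ∫⁻ η, kk Z (ξ, η) = ∫⁻ η, ∫⁻ ξ, kk Z (ξ, η) :=
        lintegral_lintegral_swap (f := fun ξ η => kk Z (ξ, η)) hkm.aemeasurable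
    _ = ∫⁻ η, ∫⁻ b, kk Z (b + η, η) :=
        lintegral_congr fun η => (lintegral_add_right_eq_self (fun ξ => kk Z (ξ, η)) η).symm
    _ = ∫⁻ b, ∫⁻ η, kk Z (b + η, η) :=
        lintegral_lintegral_swap (f := fun η b => kk Z (b + η, η)) hkm2.aemeasurable

lemma kk_inner (Z : E3 → ℝ≥0∞) (C : ℝ≥0) (b : E3)
    (hC : ∫⁻ y : E3, (if ‖y‖ ≤ ‖b‖ then (nn (b + y))⁻¹ * (nn y)⁻¹ else 0) ≤ C * nn b) :
    ∫⁻ η, kk Z (b + η, η) ≤ C * (nn b * Z b ^ 2) := by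
  have hm : Measurable fun η : E3 => if ‖η‖ ≤ ‖b‖ then (nn (b + η))⁻¹ * (nn η)⁻¹ else 0 :=
    Measurable.ite (measurableSet_le (by fun_prop) (by fun_prop))
      ((measurable_nn.comp (measurable_const_add b)).inv.mul measurable_nn.inv)
      measurable_const
  calc ∫⁻ η, kk Z (b + η, η)
      = ∫⁻ η, Z b ^ 2 *
          (if ‖η‖ ≤ ‖b‖ then (nn (b + η))⁻¹ * (nn η)⁻¹ else 0) := by
        refine lintegral_congr fun η => ?_
        simp only [kk, add_sub_cancel_right]
        split_ifs
        · ring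
        · simp
    _ = Z b ^ 2 * ∫⁻ η, (if ‖η‖ ≤ ‖b‖ then (nn (b + η))⁻¹ * (nn η)⁻¹ else 0) :=
        lintegral_const_mul _ hm
    _ ≤ Z b ^ 2 * (C * nn b) := mul_le_mul_right hC _
    _ = C * (nn b * Z b ^ 2) := by ring

lemma kk_outer (Z : E3 → ℝ≥0∞) (hZ : Measurable Z) (ξ : E3) :
    nn ξ * ((nn ξ)⁻¹ * ∫⁻ η, Z (ξ - η) * Z η) ^ 2
      ≤ (4 * ∫⁻ x, nn x * Z x ^ 2) * ∫⁻ η, kk Z (ξ, η) := by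
  have h1 := conv_sq_bound Z hZ ξ
  have h2 : (nn ξ)⁻¹ * (∫⁻ η, if ‖η‖ ≤ ‖ξ - η‖ then (nn η)⁻¹ * Z (ξ - η) ^ 2 else 0)
      ≤ ∫⁻ η, kk Z (ξ, η) := lintegral_const_mul_le _ _
  generalize (∫⁻ η, if ‖η‖ ≤ ‖ξ - η‖ then (nn η)⁻¹ * Z (ξ - η) ^ 2 else 0) = B at h1 h2
  generalize (∫⁻ η, Z (ξ - η) * Z η) = A at h1 ⊢
  generalize (∫⁻ η, kk Z (ξ, η)) = D at h2 ⊢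
  generalize (∫⁻ x, nn x * Z x ^ 2) = N at h1 ⊢
  calc nn ξ * ((nn ξ)⁻¹ * A) ^ 2 = (nn ξ * (nn ξ)⁻¹) * ((nn ξ)⁻¹ * A ^ 2) := by ring
    _ ≤ 1 * ((nn ξ)⁻¹ * (4 * (N * B))) :=
        mul_le_mul' (ENNReal.mul_inv_le_one _) (mul_le_mul_right h1 _)
    _ = (4 * N) * ((nn ξ)⁻¹ * B) := by ring
    _ ≤ (4 * N) * D := mul_le_mul_right h2 _

lemma main_bound : ∃ C : ℝ≥0, ∀ Z : E3 → ℝ≥0∞, Measurable Z →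
    ∫⁻ ξ, nn ξ * ((nn ξ)⁻¹ * ∫⁻ η, Z (ξ - η) * Z η) ^ 2
      ≤ C * (∫⁻ ξ, nn ξ * Z ξ ^ 2) ^ 2 := by
  obtain ⟨C, hC⟩ := kernel_bound
  refine ⟨4 * C, fun Z hZ => ?_⟩
  have h1 := lintegral_mono (μ := (volume : Measure E3)) (kk_outer Z hZ)
  have h2 : Measurable fun ξ : E3 => ∫⁻ η, kk Z (ξ, η) := (measurable_kk Z hZ).lintegral_prod_right'
  rw [lintegral_const_mul _ h2, kk_swap Z hZ] at h1
  have h3 : ∫⁻ b, ∫⁻ η, kk Z (b + η, η) ≤ C * ∫⁻ b, nn b * Z b ^ 2 := by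
    have h4 : Measurable fun b : E3 => nn b * Z b ^ 2 := measurable_nn.mul (hZ.pow_const 2)
    rw [← lintegral_const_mul _ h4]
    exact lintegral_mono fun b => kk_inner Z C b (hC b)
  refine h1.trans ((mul_le_mul_right h3 _).trans (le_of_eq ?_))
  push_cast
  ring

theorem bilinear_estimate_H_half :
    ∃ C : ℝ≥0, 0 < C ∧ ∀ Z : EuclideanSpace ℝ (Fin 3) → ℝ≥0∞, Measurable Z →
      (∫⁻ ξ, ENNReal.ofReal ‖ξ‖ *
          ((ENNReal.ofReal ‖ξ‖)⁻¹ * ∫⁻ η, Z (ξ - η) * Z η) ^ 2) ^ ((1 : ℝ) / 2)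
        ≤ C * ((∫⁻ ξ, ENNReal.ofReal ‖ξ‖ * (Z ξ) ^ 2) ^ ((1 : ℝ) / 2)) ^ 2 := by
  obtain ⟨C, hC⟩ := main_bound
  refine ⟨C + 1, by positivity, fun Z hZ => ?_⟩
  have h := hC Z hZ
  simp only [nn] at h
  set N := ∫⁻ ξ, ENNReal.ofReal ‖ξ‖ * (Z ξ) ^ 2
  have e : (N ^ ((1 : ℝ) / 2)) ^ 2 = N := by
    rw [← ENNReal.rpow_two, ← ENNReal.rpow_mul]; norm_num
  rw [e]
  have h2 : (C : ℝ≥0∞) * N ^ 2 ≤ (((C + 1 : ℝ≥0) : ℝ≥0∞) * N) ^ 2 := by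
    rw [mul_pow]
    gcongr
    rw [← ENNReal.coe_pow]
    norm_cast
    nlinarith [C.2, sq_nonneg C, zero_le (a := C)]
  calc _ ≤ ((((C + 1 : ℝ≥0) : ℝ≥0∞) * N) ^ 2) ^ ((1 : ℝ) / 2) :=
        ENNReal.rpow_le_rpow (h.trans h2) (by norm_num)
    _ = _ := by
      rw [← ENNReal.rpow_two, ← ENNReal.rpow_mul]; norm_num
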